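/- Let (γ♯, λ♯) be an eligible pair and Θ₁♯ := (1, −γ♯ᵀ)ᵀ / (1 − γ⁰ᵀΣ_{-1,-1}γ♯), with Θ₁,₁♯ := (1 − γ⁰ᵀΣ_{-1,-1}γ♯)^{-1}. Let b̂₁♯ := (b̂_{I,1}♯ + b̂_{II,1}♯)/2 be the sample-split debiased estimator based on Θ₁♯. Suppose that, uniformly in β⁰ ∈ B, ‖Σ^{1/2}(β̂_I − β⁰)‖₂ = o_{P_{β⁰}}(1), ‖Σ^{1/2}(β̂_{II} − β⁰)‖₂ = o_{P_{β⁰}}(1), √n λ♯ ‖β̂_I − β⁰‖₁ = o_{P_{β⁰}}(1) and √n λ♯ ‖β̂_{II} − β⁰‖₁ = o_{P_{β⁰}}(1). Then, uniformly in β⁰ ∈ B, b̂₁♯ − β₁⁰ = Θ₁♯ᵀXᵀε/n + o_{P_{β⁰}}(1/√n), and for every z ∈ ℝ, sup_{β⁰ ∈ B} | P_{β⁰}( √n (b̂₁♯ − β₁⁰)/√(Θ₁,₁♯) ≤ z ) − Φ(z) | → 0 as n → ∞, where Φ is the standard normal distribution function. -/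

import Mathlib

open MeasureTheory ProbabilityTheory Filter Matrix

noncomputable section

/-- `μx` is the law of a centered Gaussian vector with covariance `Sig`, characterized
through its one-dimensional projections. -/
def IsCenteredGaussianLaw {p : ℕ} (μx : Measure (Fin p → ℝ))
    (Sig : Matrix (Fin p) (Fin p) ℝ) : Prop :=
  IsProbabilityMeasure μx ∧
    ∀ a : Fin p → ℝ,
      Measure.map (fun x => ∑ j, a j * x j) μx
        = gaussianReal 0 (Real.toNNReal (a ⬝ᵥ (Sig *ᵥ a)))

/-- The law of one observation `(x, y)` with `y = xβ + ε`, `ε ~ N(0,1)` independent of `x`. -/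
def jointLaw {p : ℕ} (μx : Measure (Fin p → ℝ)) (β : Fin p → ℝ) :
    Measure ((Fin p → ℝ) × ℝ) :=
  Measure.map (fun v => (v.1, (∑ j, v.1 j * β j) + v.2)) (μx.prod (gaussianReal 0 1))

/-- The law `P_β` of an i.i.d. sample of size `n` from `jointLaw μx β`. -/
def sampleLaw (n : ℕ) {p : ℕ} (μx : Measure (Fin p → ℝ)) (β : Fin p → ℝ) :
    Measure (Fin n → (Fin p → ℝ) × ℝ) :=
  Measure.pi fun _ => jointLaw μx β

/-- The standard normal cumulative distribution function `Φ`. -/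
def stdNormCDF (z : ℝ) : ℝ := ((gaussianReal 0 1) (Set.Iic z)).toReal

/-- The lower-right block `Σ_{-1,-1}` of `Σ`. -/
def minorMat {q : ℕ} (Sig : Matrix (Fin (q + 1)) (Fin (q + 1)) ℝ) :
    Matrix (Fin q) (Fin q) ℝ :=
  Sig.submatrix Fin.succ Fin.succ

/-- The direction `Θ₁♯ := (1, -γ♯ᵀ)ᵀ / (1 - γ⁰ᵀ Σ_{-1,-1} γ♯)`. -/
noncomputable def thetaSharp {q : ℕ} (Sig : Matrix (Fin (q + 1)) (Fin (q + 1)) ℝ)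
    (γ0 γs : Fin q → ℝ) : Fin (q + 1) → ℝ :=
  fun i => (Fin.cons (1 : ℝ) (fun j => -(γs j)) : Fin (q + 1) → ℝ) i /
    (1 - γ0 ⬝ᵥ (minorMat Sig *ᵥ γs))

/-- First half of a sample of size `m + m`. -/
def firstHalf {m : ℕ} {α : Type*} (ω : Fin (m + m) → α) : Fin m → α :=
  fun i => ω (Fin.castAdd m i)

/-- Second half of a sample of size `m + m`. -/
def secondHalf {m : ℕ} {α : Type*} (ω : Fin (m + m) → α) : Fin m → α :=
  fun i => ω (Fin.natAdd m i)

/-- One half-sample debiased estimator, e.g.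
`b̂_{I,1}♯ := β̂_{II,1} + 2 Θ₁♯ᵀ X_Iᵀ (Y_I - X_I β̂_{II}) / n` with `n = m + m`. -/
noncomputable def debiasedHalf (m : ℕ) {q : ℕ} (Θ : Fin (q + 1) → ℝ)
    (βother : Fin (q + 1) → ℝ) (half : Fin m → (Fin (q + 1) → ℝ) × ℝ) : ℝ :=
  βother 0 + 2 * (∑ i, (∑ j, Θ j * (half i).1 j) *
      ((half i).2 - ∑ j, (half i).1 j * βother j)) / (m + m)


theorem aux_quad_lower {n : ℕ} (A : Matrix (Fin n) (Fin n) ℝ) (hA : A.IsHermitian) (c : ℝ)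
    (h : ∀ i, c ≤ hA.eigenvalues i) (x : Fin n → ℝ) :
    c * (x ⬝ᵥ x) ≤ x ⬝ᵥ (A *ᵥ x) := by
  have hB : (A - c • (1 : Matrix (Fin n) (Fin n) ℝ)).PosSemidef := by
    rw [Matrix.posSemidef_iff_isHermitian_and_spectrum_nonneg]
    refine ⟨?_, ?_⟩
    · refine hA.sub ?_
      simp [Matrix.IsHermitian]
    · intro r hr
      have e : c • (1 : Matrix (Fin n) (Fin n) ℝ) = algebraMap ℝ _ c := by
        rw [Algebra.algebraMap_eq_smul_one]
      rw [e, spectrum.mem_iff] at hr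
      have hr2 : r + c ∈ spectrum ℝ A := by
        rw [spectrum.mem_iff]
        convert hr using 2
        rw [map_add]; abel
      rw [hA.spectrum_real_eq_range_eigenvalues] at hr2
      obtain ⟨i, hi⟩ := hr2
      have := h i
      simp only [Set.mem_ofPred_eq]
      linarith
  have := hB.dotProduct_mulVec_nonneg x
  simp only [star_trivial, Matrix.sub_mulVec, Matrix.smul_mulVec, Matrix.one_mulVec,
    dotProduct_sub, dotProduct_smul, smul_eq_mul] at this
  linarith

theorem aux_halves {α : Type*} [MeasurableSpace α] (ν : Measure α) [IsProbabilityMeasure ν]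
    (m : ℕ) : MeasurePreserving (fun ω : Fin (m + m) → α => (firstHalf ω, secondHalf ω))
      (Measure.pi fun _ => ν) ((Measure.pi fun _ => ν).prod (Measure.pi fun _ => ν)) := by
  have h1 := (measurePreserving_piCongrLeft (α := fun _ : Fin (m+m) => α) (fun _ => ν)
    (finSumFinEquiv (m := m) (n := m))).symm
  have h2 := measurePreserving_sumPiEquivProdPi (X := fun _ : Fin m ⊕ Fin m => α) (fun _ => ν)
  have := h2.comp h1
  convert this using 1
  rfl

theorem aux_halves' {α : Type*} [MeasurableSpace α] (ν : Measure α) [IsProbabilityMeasure ν]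
    (m : ℕ) : MeasurePreserving (fun ω : Fin (m + m) → α => (secondHalf ω, firstHalf ω))
      (Measure.pi fun _ => ν) ((Measure.pi fun _ => ν).prod (Measure.pi fun _ => ν)) :=
  Measure.measurePreserving_swap.comp (aux_halves ν m)

/-- Fourth moment constant. -/
def auxK : ℝ := ∫ x, x ^ 4 ∂(gaussianReal 0 1)

theorem auxK_nonneg : 0 ≤ auxK := integral_nonneg fun x => by positivity

section
variable {p : ℕ} {μx : Measure (Fin p → ℝ)} {S : Matrix (Fin p) (Fin p) ℝ}

theorem aux_lin_meas (a : Fin p → ℝ) : Measurable (fun x : Fin p → ℝ => ∑ j, a j * x j) := by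
  fun_prop

theorem aux_memLp (h : IsCenteredGaussianLaw μx S) (a : Fin p → ℝ) (r : ENNReal) (hr : r ≠ ⊤) :
    MemLp (fun x : Fin p → ℝ => ∑ j, a j * x j) r μx := by
  have h1 := memLp_id_gaussianReal' (μ := 0) (v := Real.toNNReal (a ⬝ᵥ (S *ᵥ a))) r hr
  rw [← h.2 a] at h1
  exact (memLp_map_measure_iff aestronglyMeasurable_id (aux_lin_meas a).aemeasurable).1 h1

theorem aux_sq (h : IsCenteredGaussianLaw μx S) (hS : S.PosDef) (a : Fin p → ℝ) :
    ∫ x, (∑ j, a j * x j) ^ 2 ∂μx = a ⬝ᵥ (S *ᵥ a) := by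
  have h0 : 0 ≤ a ⬝ᵥ (S *ᵥ a) := by simpa using hS.posSemidef.dotProduct_mulVec_nonneg a
  have h1 : ∫ y, y ^ 2 ∂(Measure.map (fun x => ∑ j, a j * x j) μx)
      = ∫ x, (∑ j, a j * x j) ^ 2 ∂μx :=
    integral_map (aux_lin_meas a).aemeasurable (by fun_prop)
  rw [← h1, h.2 a]
  have := variance_fun_id_gaussianReal (μ := 0) (v := Real.toNNReal (a ⬝ᵥ (S *ᵥ a)))
  rw [variance_eq_integral (by fun_prop)] at this
  simpa [h0] using this

theorem aux_four (h : IsCenteredGaussianLaw μx S) (hS : S.PosDef) (a : Fin p → ℝ) :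
    ∫ x, (∑ j, a j * x j) ^ 4 ∂μx = auxK * (a ⬝ᵥ (S *ᵥ a)) ^ 2 := by
  have h0 : 0 ≤ a ⬝ᵥ (S *ᵥ a) := by simpa using hS.posSemidef.dotProduct_mulVec_nonneg a
  have h1 : ∫ y, y ^ 4 ∂(Measure.map (fun x => ∑ j, a j * x j) μx)
      = ∫ x, (∑ j, a j * x j) ^ 4 ∂μx :=
    integral_map (aux_lin_meas a).aemeasurable (by fun_prop)
  rw [← h1, h.2 a]
  set q := a ⬝ᵥ (S *ᵥ a)
  have h2 : gaussianReal 0 (Real.toNNReal q)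
      = (gaussianReal 0 1).map (fun x => Real.sqrt q * x) := by
    rw [gaussianReal_map_const_mul]
    congr 1
    · simp
    · ext; simp [h0]
  rw [h2, integral_map (by fun_prop) (by fun_prop)]
  simp_rw [mul_pow]
  rw [integral_const_mul, auxK, mul_comm]
  congr 1
  rw [show (4:ℕ) = 2 * 2 by norm_num, pow_mul, Real.sq_sqrt h0]

theorem aux_cross (h : IsCenteredGaussianLaw μx S) (hS : S.PosDef) (hsym : S.IsSymm)
    (a b : Fin p → ℝ) :
    ∫ x, (∑ j, a j * x j) * (∑ j, b j * x j) ∂μx = a ⬝ᵥ (S *ᵥ b) := by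
  have h1 := aux_sq h hS (a + b)
  have h2 := aux_sq h hS (a - b)
  have e1 : ∀ x : Fin p → ℝ, (∑ j, a j * x j) * (∑ j, b j * x j) =
     4⁻¹ * (((∑ j, (a + b) j * x j) ^ 2) - (∑ j, (a - b) j * x j) ^ 2) := by
    intro x
    simp only [Pi.add_apply, Pi.sub_apply, add_mul, sub_mul, Finset.sum_add_distrib,
      Finset.sum_sub_distrib]
    ring
  simp_rw [e1]
  rw [integral_const_mul, integral_sub (aux_memLp h _ 2 (by simp)).integrable_sq
    (aux_memLp h _ 2 (by simp)).integrable_sq, h1, h2]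
  have e2 : b ⬝ᵥ (S *ᵥ a) = a ⬝ᵥ (S *ᵥ b) := by
    rw [dotProduct_mulVec, ← mulVec_transpose, hsym.eq, dotProduct_comm]
  simp only [mulVec_add, mulVec_sub, dotProduct_add, dotProduct_sub, add_dotProduct,
    sub_dotProduct, e2]
  ring

theorem aux_prod_memLp (h : IsCenteredGaussianLaw μx S) (a b : Fin p → ℝ) :
    MemLp (fun x : Fin p → ℝ => (∑ j, a j * x j) * (∑ j, b j * x j)) 2 μx := by
  have : ENNReal.HolderTriple 4 4 2 := ⟨by
    rw [← ENNReal.toReal_eq_toReal_iff' (by simp) (by simp)]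
    rw [ENNReal.toReal_add (by simp) (by simp)]
    norm_num⟩
  exact MemLp.mul (p := 4) (q := 4) (aux_memLp h b 4 (by simp)) (aux_memLp h a 4 (by simp))

theorem aux_prod_sq_le (h : IsCenteredGaussianLaw μx S) (hS : S.PosDef) (a b : Fin p → ℝ)
    (C e : ℝ) (he : 0 < e) (ha : a ⬝ᵥ (S *ᵥ a) ≤ C) (hb : b ⬝ᵥ (S *ᵥ b) ≤ e) :
    ∫ x, ((∑ j, a j * x j) * (∑ j, b j * x j)) ^ 2 ∂μx ≤ auxK * (C ^ 2 + 1) * e := by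
  have i4 : ∀ a : Fin p → ℝ, Integrable (fun x : Fin p → ℝ => (∑ j, a j * x j) ^ 4) μx := by
    intro a
    have := (aux_memLp h a 4 (by simp)).integrable_norm_pow (p := 4) (by simp)
    refine this.congr (Eventually.of_forall fun x => ?_)
    simp only [Real.norm_eq_abs]
    exact Even.pow_abs (by decide) _
  have a0 : 0 ≤ a ⬝ᵥ (S *ᵥ a) := by simpa using hS.posSemidef.dotProduct_mulVec_nonneg a
  have b0 : 0 ≤ b ⬝ᵥ (S *ᵥ b) := by simpa using hS.posSemidef.dotProduct_mulVec_nonneg b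
  calc ∫ x, ((∑ j, a j * x j) * (∑ j, b j * x j)) ^ 2 ∂μx
      ≤ ∫ x, (e * (∑ j, a j * x j) ^ 4 + e⁻¹ * (∑ j, b j * x j) ^ 4) ∂μx := by
        refine integral_mono (aux_prod_memLp h a b).integrable_sq
          (((i4 a).const_mul _).add ((i4 b).const_mul _)) fun x => ?_
        simp only
        generalize (∑ j, a j * x j) = u
        generalize (∑ j, b j * x j) = v
        have h1 : 0 ≤ e⁻¹ * (e * u ^ 2 - v ^ 2) ^ 2 := by positivity
        have h2 : e⁻¹ * (e * u ^ 2 - v ^ 2) ^ 2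
            = e * u ^ 4 - 2 * (u * v) ^ 2 + e⁻¹ * v ^ 4 := by
          field_simp
          ring
        have := sq_nonneg (u * v)
        linarith
    _ = e * (auxK * (a ⬝ᵥ (S *ᵥ a)) ^ 2) + e⁻¹ * (auxK * (b ⬝ᵥ (S *ᵥ b)) ^ 2) := by
        rw [integral_add ((i4 a).const_mul _) ((i4 b).const_mul _), integral_const_mul,
          integral_const_mul, aux_four h hS, aux_four h hS]
    _ ≤ e * (auxK * C ^ 2) + e⁻¹ * (auxK * e ^ 2) := by
        have := auxK_nonneg
        gcongr
    _ = auxK * (C ^ 2 + 1) * e := by field_simp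

end

section
variable {p : ℕ} {μx : Measure (Fin p → ℝ)} {S : Matrix (Fin p) (Fin p) ℝ}

theorem aux_joint_meas (β : Fin p → ℝ) :
    Measurable (fun v : (Fin p → ℝ) × ℝ => (v.1, (∑ j, v.1 j * β j) + v.2)) := by
  fun_prop

theorem aux_joint_prob [IsProbabilityMeasure μx] (β : Fin p → ℝ) :
    IsProbabilityMeasure (jointLaw μx β) :=
  Measure.isProbabilityMeasure_map (aux_joint_meas β).aemeasurable

theorem aux_joint_fst [IsProbabilityMeasure μx] (β : Fin p → ℝ) :
    MeasurePreserving Prod.fst (jointLaw μx β) μx := by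
  refine ⟨measurable_fst, ?_⟩
  rw [jointLaw, Measure.map_map measurable_fst (aux_joint_meas β)]
  change Measure.map Prod.fst _ = _
  rw [Measure.map_fst_prod]
  simp

/-- The centred empirical cross moment. -/
def auxG (m : ℕ) (S : Matrix (Fin p) (Fin p) ℝ) (Θ δ : Fin p → ℝ)
    (a : Fin m → (Fin p → ℝ) × ℝ) : ℝ :=
  (∑ i, (∑ j, Θ j * (a i).1 j) * (∑ j, δ j * (a i).1 j)) / m - Θ ⬝ᵥ (S *ᵥ δ)

theorem aux_cheb (h : IsCenteredGaussianLaw μx S) (hS : S.PosDef) (hsym : S.IsSymm)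
    (β Θ δ : Fin p → ℝ) (C e t : ℝ) (he : 0 < e) (ht : 0 < t)
    (hΘ : Θ ⬝ᵥ (S *ᵥ Θ) ≤ C) (hδ : δ ⬝ᵥ (S *ᵥ δ) ≤ e) (m : ℕ) (hm : 0 < m) :
    sampleLaw m μx β {a | t < |auxG m S Θ δ a|}
      ≤ ENNReal.ofReal (auxK * (C ^ 2 + 1) * e / (m * t ^ 2)) := by
  have hP := h.1
  have hJ := aux_joint_prob (μx := μx) β
  set f : (Fin p → ℝ) → ℝ := fun x => (∑ j, Θ j * x j) * (∑ j, δ j * x j) with hf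
  have hfm : Measurable f := by fun_prop
  have hfL : MemLp f 2 μx := aux_prod_memLp h Θ δ
  have hgL : MemLp (fun v : (Fin p → ℝ) × ℝ => f v.1) 2 (jointLaw μx β) :=
    hfL.comp_measurePreserving (aux_joint_fst β)
  have hmean : ∫ v, f v.1 ∂(jointLaw μx β) = Θ ⬝ᵥ (S *ᵥ δ) := by
    rw [← aux_cross h hS hsym Θ δ]
    conv_rhs => rw [← (aux_joint_fst (μx := μx) β).map_eq]
    rw [integral_map (by fun_prop) (by fun_prop)]
  have hvar : Var[fun v : (Fin p → ℝ) × ℝ => f v.1; jointLaw μx β]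
      ≤ auxK * (C ^ 2 + 1) * e := by
    refine (variance_le_expectation_sq hgL.1).trans ?_
    refine le_trans (le_of_eq ?_) (aux_prod_sq_le h hS Θ δ C e he hΘ hδ)
    conv_rhs => rw [← (aux_joint_fst (μx := μx) β).map_eq]
    rw [integral_map (by fun_prop) (by fun_prop)]
    rfl
  set X : (Fin m → (Fin p → ℝ) × ℝ) → ℝ := ∑ i, fun ω => f (ω i).1 with hX
  have hXL : MemLp X 2 (sampleLaw m μx β) :=
    memLp_finsetSum' _ fun i _ => hgL.comp_measurePreserving
      (measurePreserving_eval (fun _ : Fin m => jointLaw μx β) i)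
  have hXvar : Var[X; sampleLaw m μx β] ≤ m * (auxK * (C ^ 2 + 1) * e) := by
    have := variance_sum_pi (μ := fun _ : Fin m => jointLaw μx β)
      (X := fun _ v => f v.1) (fun _ => hgL)
    rw [hX, sampleLaw, this]
    simp only [Finset.sum_const, Finset.card_univ, Fintype.card_fin, nsmul_eq_mul]
    gcongr
  have hXmean : ∫ a, X a ∂(sampleLaw m μx β) = m * (Θ ⬝ᵥ (S *ᵥ δ)) := by
    simp only [hX, Finset.sum_apply]
    rw [integral_finsetSum]
    · have : ∀ i : Fin m, ∫ a, f (a i).1 ∂(sampleLaw m μx β) = Θ ⬝ᵥ (S *ᵥ δ) := by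
        intro i
        rw [← hmean]
        conv_rhs => rw [← (measurePreserving_eval (fun _ : Fin m => jointLaw μx β) i).map_eq]
        rw [integral_map (measurable_pi_apply i).aemeasurable (by fun_prop)]
        rfl
      simp [this]
    · intro i _
      exact (hgL.comp_measurePreserving
        (measurePreserving_eval (fun _ : Fin m => jointLaw μx β) i)).integrable (by norm_num)
  have hm' : (0:ℝ) < m := by exact_mod_cast hm
  have : IsProbabilityMeasure (sampleLaw m μx β) := by unfold sampleLaw; infer_instance
  have hc := meas_ge_le_variance_div_sq hXL (c := m * t) (by positivity)
  refine (measure_mono ?_).trans (hc.trans ?_)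
  · intro a ha
    simp only [Set.mem_ofPred_eq] at ha ⊢
    rw [hXmean]
    have e1 : X a - m * (Θ ⬝ᵥ (S *ᵥ δ)) = m * auxG m S Θ δ a := by
      simp only [hX, Finset.sum_apply, auxG, hf]
      field_simp
    rw [e1, abs_mul, abs_of_pos hm']
    gcongr
  · apply ENNReal.ofReal_le_ofReal
    rw [div_le_div_iff₀ (by positivity) (by positivity)]
    calc _ ≤ m * (auxK * (C ^ 2 + 1) * e) * (m * t ^ 2) := by gcongr
      _ = _ := by ring

theorem auxG_meas (m : ℕ) (Θ β : Fin p → ℝ) {A : Type*} [MeasurableSpace A]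
    (F : A → Fin m → (Fin p → ℝ) × ℝ) (g : A → Fin p → ℝ)
    (hF : Measurable F) (hg : Measurable g) :
    Measurable (fun z => auxG m S Θ (fun j => g z j - β j) (F z)) := by
  unfold auxG
  simp only [dotProduct, mulVec]
  fun_prop

theorem aux_quad_meas (β : Fin p → ℝ) {A : Type*} [MeasurableSpace A]
    (g : A → Fin p → ℝ) (hg : Measurable g) :
    Measurable (fun z => (fun j => g z j - β j) ⬝ᵥ (S *ᵥ (fun j => g z j - β j))) := by
  simp only [dotProduct, mulVec]
  fun_prop

theorem aux_half (h : IsCenteredGaussianLaw μx S) (hS : S.PosDef) (hsym : S.IsSymm)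
    (β Θ : Fin p → ℝ) (C η t : ℝ) (he : 0 < η) (ht : 0 < t)
    (hΘ : Θ ⬝ᵥ (S *ᵥ Θ) ≤ C) (m : ℕ) (hm : 0 < m)
    (g : (Fin m → (Fin p → ℝ) × ℝ) → Fin p → ℝ) (hg : Measurable g)
    (F1 F2 : (Fin (m + m) → (Fin p → ℝ) × ℝ) → (Fin m → (Fin p → ℝ) × ℝ))
    (hF : MeasurePreserving (fun ω => (F1 ω, F2 ω)) (sampleLaw (m + m) μx β)
      ((sampleLaw m μx β).prod (sampleLaw m μx β))) :
    sampleLaw (m + m) μx β {ω | t < |auxG m S Θ (fun j => g (F2 ω) j - β j) (F1 ω)|}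
      ≤ sampleLaw (m + m) μx β {ω | η < Real.sqrt ((fun j => g (F2 ω) j - β j) ⬝ᵥ
              (S *ᵥ (fun j => g (F2 ω) j - β j)))}
        + ENNReal.ofReal (auxK * (C ^ 2 + 1) * η ^ 2 / (m * t ^ 2)) := by
  have hP := h.1
  have hJ := aux_joint_prob (μx := μx) β
  have : IsProbabilityMeasure (sampleLaw m μx β) := by unfold sampleLaw; infer_instance
  set T : Set ((Fin m → (Fin p → ℝ) × ℝ) × (Fin m → (Fin p → ℝ) × ℝ)) :=
    {z | (fun j => g z.2 j - β j) ⬝ᵥ (S *ᵥ (fun j => g z.2 j - β j)) ≤ η ^ 2 ∧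
      t < |auxG m S Θ (fun j => g z.2 j - β j) z.1|} with hT
  have hTm : MeasurableSet T := by
    have q1 := aux_quad_meas (S := S) β
      (fun z : (Fin m → (Fin p → ℝ) × ℝ) × (Fin m → (Fin p → ℝ) × ℝ) => g z.2)
      (hg.comp measurable_snd)
    have q2 := auxG_meas (S := S) m Θ β
      (fun z : (Fin m → (Fin p → ℝ) × ℝ) × (Fin m → (Fin p → ℝ) × ℝ) => z.1) (fun z => g z.2)
      measurable_fst (hg.comp measurable_snd)
    have q3 := measurableSet_le q1 (measurable_const (a := η ^ 2))
    have q4 := measurableSet_lt (measurable_const (a := t)) (measurable_abs.comp q2)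
    exact q3.inter q4
  have hT2 : ((sampleLaw m μx β).prod (sampleLaw m μx β)) T
      ≤ ENNReal.ofReal (auxK * (C ^ 2 + 1) * η ^ 2 / (m * t ^ 2)) := by
    rw [Measure.prod_apply_symm hTm]
    calc _ ≤ ∫⁻ b, ENNReal.ofReal (auxK * (C ^ 2 + 1) * η ^ 2 / (m * t ^ 2))
            ∂(sampleLaw m μx β) := by
          refine lintegral_mono fun b => ?_
          by_cases hb : (fun j => g b j - β j) ⬝ᵥ (S *ᵥ (fun j => g b j - β j)) ≤ η ^ 2
          · refine (measure_mono ?_).trans (aux_cheb h hS hsym β Θ (fun j => g b j - β j) C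
              (η ^ 2) t (by positivity) ht hΘ hb m hm)
            intro a ha
            exact ha.2
          · have : (fun x => (x, b)) ⁻¹' T = ∅ := by
              ext a
              simp only [Set.mem_preimage, Set.mem_empty_iff_false, iff_false]
              exact fun ha => hb ha.1
            rw [this]; simp
      _ = _ := by simp
  calc _ ≤ sampleLaw (m + m) μx β ({ω | η < Real.sqrt ((fun j => g (F2 ω) j - β j) ⬝ᵥ
              (S *ᵥ (fun j => g (F2 ω) j - β j)))} ∪ (fun ω => (F1 ω, F2 ω)) ⁻¹' T) := by
        refine measure_mono fun ω hω => ?_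
        by_cases hb : (fun j => g (F2 ω) j - β j) ⬝ᵥ (S *ᵥ (fun j => g (F2 ω) j - β j)) ≤ η ^ 2
        · right; exact ⟨hb, hω⟩
        · left
          exact (Real.lt_sqrt he.le).2 (not_le.1 hb)
    _ ≤ _ := (measure_union_le _ _).trans (by
        rw [hF.measure_preimage hTm.nullMeasurableSet]
        gcongr)

end

theorem aux_clt (z : ℝ) :
    Tendsto (fun n : ℕ => ((Measure.pi fun _ : Fin n =>
      (gaussianReal 0 1).prod (gaussianReal 0 1))
        {v | (Real.sqrt n)⁻¹ * ∑ i, (v i).1 * (v i).2 ≤ z}).toReal) atTop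
      (nhds (stdNormCDF z)) := by
  set ν : Measure (ℝ × ℝ) := (gaussianReal 0 1).prod (gaussianReal 0 1) with hν
  set P : Measure (ℕ → ℝ × ℝ) := Measure.infinitePi (fun _ => ν) with hP
  set X : ℕ → (ℕ → ℝ × ℝ) → ℝ := fun i ω => (ω i).1 * (ω i).2 with hX
  have hind : iIndepFun X P :=
    iIndepFun_infinitePi (P := fun _ : ℕ => ν) (X := fun _ v => v.1 * v.2) (fun _ => by fun_prop)
  have hev : ∀ i, Measure.map (fun ω : ℕ → ℝ × ℝ => ω i) P = ν := fun i =>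
    Measure.infinitePi_map_eval _ i
  have hmapX : ∀ i, Measure.map (X i) P = ν.map (fun v => v.1 * v.2) := by
    intro i
    rw [← hev i, Measure.map_map (by fun_prop) (by fun_prop)]
    rfl
  have hid : ∀ i, IdentDistrib (X i) (X 0) P P := fun i =>
    ⟨by fun_prop, by fun_prop, by rw [hmapX, hmapX]⟩
  have h0 : P[X 0] = 0 := by
    have : ∫ v, v.1 * v.2 ∂ν = 0 := by
      rw [hν, integral_prod_mul (fun x => x) (fun x => x)]; simp
    rw [← this, ← hev 0, integral_map (measurable_pi_apply 0).aemeasurable (by fun_prop)]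
  have hsq : ∫ x, x ^ 2 ∂(gaussianReal 0 1) = 1 := by
    have := variance_fun_id_gaussianReal (μ := 0) (v := 1)
    rw [variance_eq_integral (by fun_prop)] at this
    simpa using this
  have h1 : P[X 0 ^ 2] = 1 := by
    have : ∫ v : ℝ × ℝ, v.1 ^ 2 * v.2 ^ 2 ∂ν = 1 := by
      rw [hν, integral_prod_mul (fun x => x ^ 2) (fun x => x ^ 2), hsq]; simp
    rw [← this, ← hev 0, integral_map (measurable_pi_apply 0).aemeasurable (by fun_prop)]
    simp [hX, mul_pow]
  have hclt := (tendstoInDistribution_inv_sqrt_mul_sum (P := P) (P' := gaussianReal 0 1)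
    (Y := id) HasLaw.id h0 h1 hind hid).tendsto
  have := ProbabilityMeasure.tendsto_measure_of_null_frontier_of_tendsto' hclt
    (E := Set.Iic z) (by
      have := nullSingletonClass_gaussianReal (μ := 0) (v := 1) (by simp)
      simp)
  have h2 := (ENNReal.tendsto_toReal (by simp)).comp this
  have e2 : stdNormCDF z = (((gaussianReal 0 1).map id) (Set.Iic z)).toReal := by
    simp [stdNormCDF]
  rw [e2]
  refine h2.congr fun n => ?_
  simp only [Function.comp, ProbabilityMeasure.coe_mk]
  have hr : Measure.map (fun (ω : ℕ → ℝ × ℝ) (i : Fin n) => ω i) P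
      = Measure.pi fun _ : Fin n => ν := by
    have hi : iIndepFun (fun (i : Fin n) (ω : ℕ → ℝ × ℝ) => ω i) P :=
      (iIndepFun_infinitePi (P := fun _ : ℕ => ν) (X := fun _ v => v)
        (fun _ => by fun_prop)).precomp Fin.val_injective
    rw [(iIndepFun_iff_map_fun_eq_pi_map
      (fun i => (measurable_pi_apply _).aemeasurable)).1 hi]
    simp_rw [hev]
  rw [← hr, Measure.map_apply (by fun_prop) (measurableSet_Iic),
    Measure.map_apply (by fun_prop) (measurableSet_le (by fun_prop) (by fun_prop))]
  congr 2
  ext ω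
  simp only [hX, Set.mem_preimage, Set.mem_Iic, Set.mem_ofPred_eq]
  rw [Finset.sum_range]

section
variable {q : ℕ} {S : Matrix (Fin (q + 1)) (Fin (q + 1)) ℝ} {γ0 γs : Fin q → ℝ}

/-- The unnormalised direction. -/
def auxV (γs : Fin q → ℝ) : Fin (q + 1) → ℝ := Fin.cons (1 : ℝ) (fun j => -(γs j))

/-- The normalisation. -/
def auxD (S : Matrix (Fin (q + 1)) (Fin (q + 1)) ℝ) (γ0 γs : Fin q → ℝ) : ℝ :=
  1 - γ0 ⬝ᵥ (minorMat S *ᵥ γs)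

theorem aux_theta : thetaSharp S γ0 γs = fun i => auxV γs i / auxD S γ0 γs := rfl

theorem aux_sym_dot {n : ℕ} {A : Matrix (Fin n) (Fin n) ℝ} (hA : A.IsSymm) (a b : Fin n → ℝ) :
    b ⬝ᵥ (A *ᵥ a) = a ⬝ᵥ (A *ᵥ b) := by
  rw [dotProduct_mulVec, ← mulVec_transpose, hA.eq, dotProduct_comm]

theorem aux_Sv_zero (hsym : S.IsSymm) (hdiag : ∀ i, S i i = 1)
    (hγ0 : minorMat S *ᵥ γ0 = fun j => S j.succ 0) :
    (S *ᵥ auxV γs) 0 = auxD S γ0 γs := by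
  have hm : (minorMat S).IsSymm := hsym.submatrix _
  rw [auxD, aux_sym_dot hm, hγ0]
  simp only [mulVec, dotProduct, auxV, Fin.sum_univ_succ, Fin.cons_zero, Fin.cons_succ, hdiag]
  rw [mul_one, sub_eq_add_neg, ← Finset.sum_neg_distrib]
  congr 1
  refine Finset.sum_congr rfl fun j _ => ?_
  rw [hsym.apply j.succ 0]
  ring

theorem aux_Sv_succ (hγ0 : minorMat S *ᵥ γ0 = fun j => S j.succ 0) (j : Fin q) :
    (S *ᵥ auxV γs) j.succ = -(minorMat S *ᵥ (fun l => γs l - γ0 l)) j := by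
  have h1 : (fun l => γs l - γ0 l) = γs - γ0 := rfl
  rw [h1, mulVec_sub, hγ0]
  simp only [mulVec, dotProduct, auxV, Fin.sum_univ_succ, Fin.cons_zero, Fin.cons_succ,
    Pi.sub_apply, minorMat, Matrix.submatrix_apply, mul_one, mul_neg, Finset.sum_neg_distrib]
  ring

theorem aux_vSv (hsym : S.IsSymm) (hdiag : ∀ i, S i i = 1)
    (hγ0 : minorMat S *ᵥ γ0 = fun j => S j.succ 0) (lam : ℝ)
    (hE : ∀ j, |(minorMat S *ᵥ (fun l => γs l - γ0 l)) j| ≤ lam) :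
    |auxV γs ⬝ᵥ (S *ᵥ auxV γs) - auxD S γ0 γs| ≤ lam * ∑ j, |γs j| := by
  have : auxV γs ⬝ᵥ (S *ᵥ auxV γs) - auxD S γ0 γs
      = ∑ j, (minorMat S *ᵥ (fun l => γs l - γ0 l)) j * γs j := by
    rw [dotProduct, Fin.sum_univ_succ, aux_Sv_zero hsym hdiag hγ0]
    simp only [aux_Sv_succ hγ0]
    simp only [auxV, Fin.cons_zero, Fin.cons_succ]
    rw [one_mul, add_sub_cancel_left]
    exact Finset.sum_congr rfl fun j _ => by ring
  rw [this, Finset.mul_sum]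
  refine (Finset.abs_sum_le_sum_abs _ _).trans (Finset.sum_le_sum fun j _ => ?_)
  rw [abs_mul]
  gcongr
  exact hE j

theorem aux_vSv_lower (hS : S.PosDef) (c : ℝ) (hc : 0 < c) (heig : ∀ i, c ≤ hS.1.eigenvalues i) :
    c ≤ auxV γs ⬝ᵥ (S *ᵥ auxV γs) := by
  refine le_trans ?_ (aux_quad_lower S hS.1 c heig (auxV γs))
  have : 1 ≤ auxV γs ⬝ᵥ auxV γs := by
    rw [dotProduct, Fin.sum_univ_succ]
    simp only [auxV, Fin.cons_zero, Fin.cons_succ]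
    have : 0 ≤ ∑ j, -γs j * -γs j := Finset.sum_nonneg fun j _ => mul_self_nonneg _
    linarith
  nlinarith

theorem aux_D_upper (hS : S.PosDef) (hsym : S.IsSymm) (hdiag : ∀ i, S i i = 1)
    (hγ0 : minorMat S *ᵥ γ0 = fun j => S j.succ 0) :
    2 * auxD S γ0 γs ≤ 1 + auxV γs ⬝ᵥ (S *ᵥ auxV γs) := by
  have h := hS.posSemidef.dotProduct_mulVec_nonneg (Pi.single 0 1 - auxV γs)
  rw [star_trivial] at h
  simp only [mulVec_sub, dotProduct_sub, sub_dotProduct] at h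
  rw [aux_sym_dot hsym (Pi.single 0 1) (auxV γs)] at h
  simp only [single_one_dotProduct, aux_Sv_zero hsym hdiag hγ0] at h
  simp [hdiag] at h
  linarith

theorem aux_lin (hsym : S.IsSymm) (hdiag : ∀ i, S i i = 1)
    (hγ0 : minorMat S *ᵥ γ0 = fun j => S j.succ 0) (lam : ℝ) (hlam : 0 < lam)
    (hE : ∀ j, |(minorMat S *ᵥ (fun l => γs l - γ0 l)) j| ≤ lam)
    (hd : 0 < auxD S γ0 γs) (δ : Fin (q + 1) → ℝ) :
    |δ 0 - thetaSharp S γ0 γs ⬝ᵥ (S *ᵥ δ)| ≤ (auxD S γ0 γs)⁻¹ * (lam * ∑ j, |δ j|) := by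
  have e1 : δ 0 - thetaSharp S γ0 γs ⬝ᵥ (S *ᵥ δ)
      = (auxD S γ0 γs)⁻¹ * ∑ j : Fin q, (minorMat S *ᵥ (fun l => γs l - γ0 l)) j * δ j.succ := by
    have e2 : thetaSharp S γ0 γs = (auxD S γ0 γs)⁻¹ • auxV γs := by
      rw [aux_theta]; ext i; simp [div_eq_inv_mul]
    rw [e2, smul_dotProduct, aux_sym_dot hsym, dotProduct, Fin.sum_univ_succ,
      aux_Sv_zero hsym hdiag hγ0]
    simp only [aux_Sv_succ hγ0, smul_eq_mul]
    have e3 : ∑ i : Fin q, δ i.succ * -(minorMat S *ᵥ fun l => γs l - γ0 l) i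
      = - ∑ j : Fin q, (minorMat S *ᵥ (fun l => γs l - γ0 l)) j * δ j.succ := by
      rw [← Finset.sum_neg_distrib]
      exact Finset.sum_congr rfl fun j _ => by ring
    rw [e3]
    field_simp
    ring
  rw [e1, abs_mul, abs_of_pos (inv_pos.2 hd)]
  gcongr
  refine (Finset.abs_sum_le_sum_abs _ _).trans ?_
  rw [Fin.sum_univ_succ, mul_add, Finset.mul_sum]
  have : 0 ≤ lam * |δ 0| := by positivity
  refine le_trans (Finset.sum_le_sum fun j _ => ?_) (le_add_of_nonneg_left this)
  rw [abs_mul]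
  gcongr
  exact hE j

theorem aux_decomp (m : ℕ) (hm : 0 < m) (Θ β β' : Fin (q + 1) → ℝ)
    (a : Fin m → (Fin (q + 1) → ℝ) × ℝ) :
    debiasedHalf m Θ β' a - β 0 - (∑ i, (∑ j, Θ j * (a i).1 j) *
      ((a i).2 - ∑ j, (a i).1 j * β j)) / m
    = ((β' 0 - β 0) - Θ ⬝ᵥ (S *ᵥ (fun j => β' j - β j)))
      - auxG m S Θ (fun j => β' j - β j) a := by
  have hm' : (m : ℝ) ≠ 0 := by positivity
  have e : ∑ i, (∑ j, Θ j * (a i).1 j) * ((a i).2 - ∑ j, (a i).1 j * β' j)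
      = ∑ i, (∑ j, Θ j * (a i).1 j) * ((a i).2 - ∑ j, (a i).1 j * β j)
        - ∑ i, (∑ j, Θ j * (a i).1 j) * (∑ j, (β' j - β j) * (a i).1 j) := by
    rw [← Finset.sum_sub_distrib]
    refine Finset.sum_congr rfl fun i _ => ?_
    have : ∑ j, (β' j - β j) * (a i).1 j
        = ∑ j, (a i).1 j * β' j - ∑ j, (a i).1 j * β j := by
      rw [← Finset.sum_sub_distrib]
      exact Finset.sum_congr rfl fun j _ => by ring
    rw [this]; ring
  rw [debiasedHalf, auxG, e]
  field_simp
  ring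

end

theorem aux_law {p : ℕ} {μx : Measure (Fin p → ℝ)} {S : Matrix (Fin p) (Fin p) ℝ}
    (h : IsCenteredGaussianLaw μx S) (β Θ : Fin p → ℝ) (hpos : 0 < Θ ⬝ᵥ (S *ᵥ Θ))
    (n : ℕ) (z : ℝ) :
    sampleLaw n μx β {ω | (Real.sqrt n)⁻¹ * ∑ i, (∑ j, Θ j * (ω i).1 j) *
      ((ω i).2 - ∑ j, (ω i).1 j * β j) ≤ Real.sqrt (Θ ⬝ᵥ (S *ᵥ Θ)) * z}
    = (Measure.pi fun _ : Fin n => (gaussianReal 0 1).prod (gaussianReal 0 1))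
        {v | (Real.sqrt n)⁻¹ * ∑ i, (v i).1 * (v i).2 ≤ z} := by
  have hP := h.1
  have hJ := aux_joint_prob (μx := μx) β
  set τ := Real.sqrt (Θ ⬝ᵥ (S *ᵥ Θ)) with hτ
  have hτ0 : 0 < τ := Real.sqrt_pos.2 hpos
  set φ : (Fin p → ℝ) × ℝ → ℝ × ℝ :=
    fun v => ((∑ j, Θ j * v.1 j) / τ, v.2 - ∑ j, v.1 j * β j) with hφ
  have hφm : Measurable φ := by fun_prop
  have h1 : Measure.map φ (jointLaw μx β) = (gaussianReal 0 1).prod (gaussianReal 0 1) := by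
    rw [jointLaw, Measure.map_map hφm (aux_joint_meas β)]
    have e1 : φ ∘ (fun v : (Fin p → ℝ) × ℝ => (v.1, (∑ j, v.1 j * β j) + v.2))
        = Prod.map (fun x : Fin p → ℝ => (∑ j, Θ j * x j) / τ) id := by
      ext v <;> simp [hφ]
    rw [e1, ← Measure.map_prod_map _ _ (by fun_prop) measurable_id, Measure.map_id]
    congr 1
    have e2 : (fun x : Fin p → ℝ => (∑ j, Θ j * x j) / τ)
        = (fun y => y / τ) ∘ (fun x => ∑ j, Θ j * x j) := rfl
    rw [e2, ← Measure.map_map (by fun_prop) (by fun_prop), h.2 Θ, gaussianReal_map_div_const]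
    congr 1
    · simp
    · ext
      simp only [NNReal.coe_div, NNReal.coe_one, Real.coe_toNNReal _ hpos.le, NNReal.coe_mk]
      rw [hτ, Real.sq_sqrt hpos.le, div_self hpos.ne']
  have h2 : Measure.map (fun (ω : Fin n → (Fin p → ℝ) × ℝ) i => φ (ω i)) (sampleLaw n μx β)
      = Measure.pi fun _ : Fin n => (gaussianReal 0 1).prod (gaussianReal 0 1) := by
    have hI : IsProbabilityMeasure (Measure.map φ (jointLaw μx β)) :=
      Measure.isProbabilityMeasure_map hφm.aemeasurable
    rw [sampleLaw, Measure.pi_map_pi (fun _ => hφm.aemeasurable)]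
    simp_rw [h1]
  rw [← h2, Measure.map_apply (by fun_prop) (measurableSet_le (by fun_prop) (by fun_prop))]
  congr 1
  ext ω
  simp only [Set.mem_preimage, Set.mem_ofPred_eq, hφ]
  have : ∑ i, (∑ j, Θ j * (ω i).1 j) * ((ω i).2 - ∑ j, (ω i).1 j * β j)
    = τ * ∑ i, (∑ j, Θ j * (ω i).1 j) / τ * ((ω i).2 - ∑ j, (ω i).1 j * β j) := by
    rw [Finset.mul_sum]
    refine Finset.sum_congr rfl fun i _ => ?_
    field_simp
  rw [this, mul_left_comm, mul_le_mul_iff_right₀ hτ0]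

/-- The remainder of the linear expansion. -/
def auxT (m : ℕ) {q : ℕ} (Θ β : Fin (q + 1) → ℝ)
    (βI βII : (Fin m → (Fin (q + 1) → ℝ) × ℝ) → (Fin (q + 1) → ℝ))
    (ω : Fin (m + m) → (Fin (q + 1) → ℝ) × ℝ) : ℝ :=
  (debiasedHalf m Θ (βII (secondHalf ω)) (firstHalf ω) +
      debiasedHalf m Θ (βI (firstHalf ω)) (secondHalf ω)) / 2 - β 0
    - (∑ i, (∑ j, Θ j * (ω i).1 j) * ((ω i).2 - ∑ j, (ω i).1 j * β j)) / (m + m)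

section
variable {q : ℕ} {S : Matrix (Fin (q + 1)) (Fin (q + 1)) ℝ} {γ0 γs : Fin q → ℝ}

theorem aux_const (hS : S.PosDef) (hsym : S.IsSymm) (hdiag : ∀ i, S i i = 1)
    (hγ0 : minorMat S *ᵥ γ0 = fun j => S j.succ 0) (lam : ℝ)
    (hE : ∀ j, |(minorMat S *ᵥ (fun l => γs l - γ0 l)) j| ≤ lam)
    (c : ℝ) (hc : 0 < c) (heig : ∀ i, c ≤ hS.1.eigenvalues i)
    (hr : lam * ∑ j, |γs j| ≤ c / 2) :
    c / 2 ≤ auxD S γ0 γs ∧ auxD S γ0 γs ≤ 1 + lam * ∑ j, |γs j| ∧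
    0 < thetaSharp S γ0 γs ⬝ᵥ (S *ᵥ thetaSharp S γ0 γs) ∧
    thetaSharp S γ0 γs ⬝ᵥ (S *ᵥ thetaSharp S γ0 γs) ≤ 4 / c ∧
    |auxD S γ0 γs * (thetaSharp S γ0 γs ⬝ᵥ (S *ᵥ thetaSharp S γ0 γs)) - 1|
      ≤ 2 / c * (lam * ∑ j, |γs j|) := by
  have h1 := aux_vSv hsym hdiag hγ0 lam hE
  have h2 := aux_vSv_lower (γs := γs) hS c hc heig
  have h3 := aux_D_upper (γs := γs) hS hsym hdiag hγ0
  have e2 : thetaSharp S γ0 γs = (auxD S γ0 γs)⁻¹ • auxV γs := by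
    rw [aux_theta]; ext i; simp [div_eq_inv_mul]
  have e3 : thetaSharp S γ0 γs ⬝ᵥ (S *ᵥ thetaSharp S γ0 γs)
      = (auxV γs ⬝ᵥ (S *ᵥ auxV γs)) / (auxD S γ0 γs) ^ 2 := by
    rw [e2, mulVec_smul, smul_dotProduct, dotProduct_smul]
    simp only [smul_eq_mul]; ring
  rw [e3]
  generalize auxV γs ⬝ᵥ (S *ᵥ auxV γs) = u at *
  generalize auxD S γ0 γs = d at *
  generalize lam * ∑ j, |γs j| = r at *
  have h4 := abs_le.1 h1
  have hd : c / 2 ≤ d := by linarith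
  have hd0 : 0 < d := by linarith
  refine ⟨hd, by linarith, div_pos (by linarith) (by positivity), ?_, ?_⟩
  · rw [div_le_div_iff₀ (by positivity) hc]
    nlinarith
  · have : d * (u / d ^ 2) - 1 = (u - d) / d := by field_simp
    rw [this, abs_div, abs_of_pos hd0, div_le_iff₀ hd0]
    have hr0 : 0 ≤ r := (abs_nonneg _).trans h1
    have : r ≤ 2 / c * r * d := by
      have : 1 ≤ 2 / c * d := by
        rw [div_mul_eq_mul_div, le_div_iff₀ hc]; linarith
      nlinarith
    linarith

theorem aux_T_eq (m : ℕ) (hm : 0 < m) (Θ β : Fin (q + 1) → ℝ)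
    (βI βII : (Fin m → (Fin (q + 1) → ℝ) × ℝ) → (Fin (q + 1) → ℝ))
    (ω : Fin (m + m) → (Fin (q + 1) → ℝ) × ℝ) :
    auxT m Θ β βI βII ω =
     ((((βII (secondHalf ω) 0 - β 0) - Θ ⬝ᵥ (S *ᵥ (fun j => βII (secondHalf ω) j - β j)))
      - auxG m S Θ (fun j => βII (secondHalf ω) j - β j) (firstHalf ω)) +
     (((βI (firstHalf ω) 0 - β 0) - Θ ⬝ᵥ (S *ᵥ (fun j => βI (firstHalf ω) j - β j)))
      - auxG m S Θ (fun j => βI (firstHalf ω) j - β j) (secondHalf ω))) / 2 := by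
  have hm' : (m : ℝ) ≠ 0 := by positivity
  rw [← aux_decomp (S := S) m hm, ← aux_decomp (S := S) m hm, auxT, Fin.sum_univ_add]
  simp only [firstHalf, secondHalf]
  field_simp
  ring

theorem aux_bound {μx : Measure (Fin (q + 1) → ℝ)} (h : IsCenteredGaussianLaw μx S)
    (hS : S.PosDef) (hsym : S.IsSymm) (hdiag : ∀ i, S i i = 1)
    (hγ0 : minorMat S *ᵥ γ0 = fun j => S j.succ 0) (lam : ℝ) (hlam : 0 < lam)
    (hE : ∀ j, |(minorMat S *ᵥ (fun l => γs l - γ0 l)) j| ≤ lam)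
    (c : ℝ) (hc : 0 < c) (heig : ∀ i, c ≤ hS.1.eigenvalues i)
    (hr : lam * ∑ j, |γs j| ≤ c / 2) (m : ℕ) (hm : 0 < m)
    (β : Fin (q + 1) → ℝ)
    (βI βII : (Fin m → (Fin (q + 1) → ℝ) × ℝ) → (Fin (q + 1) → ℝ))
    (hI : Measurable βI) (hII : Measurable βII) (η η' : ℝ) (hη : 0 < η) (hη' : 0 < η') :
    sampleLaw (m + m) μx β {ω | η * (Real.sqrt (m + m))⁻¹ <
        |auxT m (thetaSharp S γ0 γs) β βI βII ω|} ≤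
      sampleLaw (m + m) μx β {ω | η * c / 4 <
          Real.sqrt (m + m) * lam * ∑ j, |βII (secondHalf ω) j - β j|} +
      sampleLaw (m + m) μx β {ω | η * c / 4 <
          Real.sqrt (m + m) * lam * ∑ j, |βI (firstHalf ω) j - β j|} +
      sampleLaw (m + m) μx β {ω | η' < Real.sqrt ((fun j => βII (secondHalf ω) j - β j) ⬝ᵥ
              (S *ᵥ (fun j => βII (secondHalf ω) j - β j)))} +
      sampleLaw (m + m) μx β {ω | η' < Real.sqrt ((fun j => βI (firstHalf ω) j - β j) ⬝ᵥ
              (S *ᵥ (fun j => βI (firstHalf ω) j - β j)))} +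
      2 * ENNReal.ofReal (auxK * ((4 / c) ^ 2 + 1) * 8 / η ^ 2 * η' ^ 2) := by
  have hP := h.1
  have hJ := aux_joint_prob (μx := μx) β
  have hm' : (0 : ℝ) < m := by exact_mod_cast hm
  obtain ⟨hd, -, -, hC, -⟩ := aux_const hS hsym hdiag hγ0 lam hE c hc heig hr
  have hd0 : 0 < auxD S γ0 γs := by linarith
  set Θ := thetaSharp S γ0 γs with hΘ
  set n : ℝ := (m : ℝ) + m with hn
  have hn0 : 0 < n := by positivity
  have hs0 : 0 < Real.sqrt n := Real.sqrt_pos.2 hn0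
  set t : ℝ := η * (Real.sqrt n)⁻¹ / 2 with ht
  have ht0 : 0 < t := by positivity
  have ht2 : (m : ℝ) * t ^ 2 = η ^ 2 / 8 := by
    rw [ht, div_pow, mul_pow, inv_pow, Real.sq_sqrt hn0.le, hn]
    field_simp
    ring
  have b1 := aux_half h hS hsym β Θ (4 / c) η' t hη' ht0 hC m hm βII hII firstHalf secondHalf
    (aux_halves (jointLaw μx β) m)
  have b2 := aux_half h hS hsym β Θ (4 / c) η' t hη' ht0 hC m hm βI hI secondHalf firstHalf
    (aux_halves' (jointLaw μx β) m)
  have e4 : auxK * ((4 / c) ^ 2 + 1) * η' ^ 2 / (m * t ^ 2)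
      = auxK * ((4 / c) ^ 2 + 1) * 8 / η ^ 2 * η' ^ 2 := by
    rw [ht2]; field_simp
  rw [e4] at b1 b2
  have hlin : ∀ δ : Fin (q + 1) → ℝ, t < |δ 0 - Θ ⬝ᵥ (S *ᵥ δ)| →
      η * c / 4 < Real.sqrt n * lam * ∑ j, |δ j| := by
    intro δ hδ
    have h1 := aux_lin hsym hdiag hγ0 lam hlam hE hd0 δ
    have h2 : (auxD S γ0 γs)⁻¹ ≤ (c / 2)⁻¹ := inv_anti₀ (by positivity) hd
    have h3 : 0 ≤ lam * ∑ j, |δ j| := by positivity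
    have h4 : t < (c / 2)⁻¹ * (lam * ∑ j, |δ j|) :=
      hδ.trans_le (h1.trans (mul_le_mul_of_nonneg_right h2 h3))
    have h5 : Real.sqrt n * (c / 2) * t
        < Real.sqrt n * (c / 2) * ((c / 2)⁻¹ * (lam * ∑ j, |δ j|)) :=
      mul_lt_mul_of_pos_left h4 (by positivity)
    have e5 : Real.sqrt n * (c / 2) * t = η * c / 4 := by rw [ht]; field_simp; ring
    have e6 : Real.sqrt n * (c / 2) * ((c / 2)⁻¹ * (lam * ∑ j, |δ j|))
        = Real.sqrt n * lam * ∑ j, |δ j| := by field_simp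
    rwa [e5, e6] at h5
  calc _ ≤ sampleLaw (m + m) μx β (
      ({ω | η * c / 4 < Real.sqrt n * lam * ∑ j, |βII (secondHalf ω) j - β j|} ∪
      {ω | η * c / 4 < Real.sqrt n * lam * ∑ j, |βI (firstHalf ω) j - β j|}) ∪
      ({ω | t < |auxG m S Θ (fun j => βII (secondHalf ω) j - β j) (firstHalf ω)|} ∪
      {ω | t < |auxG m S Θ (fun j => βI (firstHalf ω) j - β j) (secondHalf ω)|})) := by
        refine measure_mono fun ω hω => ?_
        simp only [Set.mem_ofPred_eq, Set.mem_union] at hω ⊢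
        rw [aux_T_eq (S := S) m hm] at hω
        by_contra hcon
        push Not at hcon
        obtain ⟨⟨k1, k2⟩, k3, k4⟩ := hcon
        have k5 := not_lt.1 (mt (hlin (fun j => βII (secondHalf ω) j - β j)) (not_lt.2 k1))
        have k6 := not_lt.1 (mt (hlin (fun j => βI (firstHalf ω) j - β j)) (not_lt.2 k2))
        have e7 : η * (Real.sqrt n)⁻¹ = 2 * t := by rw [ht]; ring
        rw [e7] at hω
        rw [abs_le] at k3 k4 k5 k6
        refine absurd hω (not_lt.2 (abs_le.2 ⟨?_, ?_⟩)) <;> linarith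
    _ ≤ _ := by
        refine (measure_union_le _ _).trans ((add_le_add (measure_union_le _ _)
          (measure_union_le _ _)).trans ((add_le_add le_rfl (add_le_add b1 b2)).trans
            (le_of_eq ?_)))
        rw [two_mul]
        abel
end

theorem aux_phi (z ε : ℝ) (hε : 0 < ε) : ∃ ρ : ℝ, 0 < ρ ∧
    stdNormCDF (z + 2 * ρ) ≤ stdNormCDF z + ε ∧ stdNormCDF z ≤ stdNormCDF (z - 2 * ρ) + ε := by
  have := nullSingletonClass_gaussianReal (μ := 0) (v := 1) (by simp)
  have h1 := tendsto_measure_Icc (gaussianReal 0 1) z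
  have h2 : ∀ᶠ δ in nhds (0 : ℝ),
      gaussianReal 0 1 (Set.Icc (z - δ) (z + δ)) < ENNReal.ofReal ε :=
    h1.eventually (gt_mem_nhds (by simpa using hε))
  obtain ⟨δ, hδ, hδ0⟩ :=
    ((h2.filter_mono nhdsWithin_le_nhds).and (self_mem_nhdsWithin (s := Set.Ioi 0))).exists
  have hδ0 : 0 < δ := hδ0
  have h3 : (gaussianReal 0 1).real (Set.Icc (z - δ) (z + δ)) ≤ ε :=
    ENNReal.toReal_le_of_le_ofReal hε.le hδ.le
  refine ⟨δ / 2, by positivity, ?_, ?_⟩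
  · have : stdNormCDF (z + 2 * (δ / 2)) ≤ (gaussianReal 0 1).real
        (Set.Iic z ∪ Set.Icc (z - δ) (z + δ)) := by
      refine measureReal_mono fun x hx => ?_
      have hx : x ≤ z + 2 * (δ / 2) := hx
      by_cases h : x ≤ z
      · left; exact h
      · right; constructor <;> linarith
    exact this.trans ((measureReal_union_le _ _).trans (add_le_add le_rfl h3))
  · have : stdNormCDF z ≤ (gaussianReal 0 1).real
        (Set.Iic (z - 2 * (δ / 2)) ∪ Set.Icc (z - δ) (z + δ)) := by
      refine measureReal_mono fun x hx => ?_
      have hx : x ≤ z := hx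
      by_cases h : x ≤ z - 2 * (δ / 2)
      · left; exact h
      · right; constructor <;> linarith
    exact this.trans ((measureReal_union_le _ _).trans (add_le_add le_rfl h3))

/-- The distribution function of the normalised sum of products. -/
def auxF (n : ℕ) (z : ℝ) : ℝ := ((Measure.pi fun _ : Fin n =>
      (gaussianReal 0 1).prod (gaussianReal 0 1))
        {v | (Real.sqrt n)⁻¹ * ∑ i, (v i).1 * (v i).2 ≤ z}).toReal

theorem auxF_mono (n : ℕ) : Monotone (auxF n) := by
  intro a b hab
  unfold auxF
  exact measureReal_mono fun v (hv : _ ≤ a) => le_trans hv hab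

theorem aux_sandwich {q : ℕ} {S : Matrix (Fin (q + 1)) (Fin (q + 1)) ℝ}
    {μx : Measure (Fin (q + 1) → ℝ)} (h : IsCenteredGaussianLaw μx S)
    (Θ β : Fin (q + 1) → ℝ) (hpos : 0 < Θ ⬝ᵥ (S *ᵥ Θ)) (d : ℝ) (hd : 0 < d) (hd4 : d ≤ 4)
    (m : ℕ) (hm : 0 < m)
    (βI βII : (Fin m → (Fin (q + 1) → ℝ) × ℝ) → (Fin (q + 1) → ℝ)) (z ρ K : ℝ) (hρ : 0 < ρ)
    (hK : (sampleLaw (m + m) μx β {ω | ρ / 2 * (Real.sqrt (m + m))⁻¹ <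
        |auxT m Θ β βI βII ω|}).toReal ≤ K) (E : ℝ)
    (hE : E = (sampleLaw (m + m) μx β
          {ω | Real.sqrt (m + m) *
              ((debiasedHalf m Θ (βII (secondHalf ω)) (firstHalf ω) +
                  debiasedHalf m Θ (βI (firstHalf ω)) (secondHalf ω)) / 2 - β 0) /
                Real.sqrt (d⁻¹) ≤ z}).toReal) :
    E ≤ auxF (m + m) ((z + ρ) / Real.sqrt (d * (Θ ⬝ᵥ (S *ᵥ Θ)))) + K ∧
    auxF (m + m) ((z - ρ) / Real.sqrt (d * (Θ ⬝ᵥ (S *ᵥ Θ)))) ≤ E + K := by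
  have hP := h.1
  have hJ := aux_joint_prob (μx := μx) β
  have hPr : IsProbabilityMeasure (sampleLaw (m + m) μx β) := by
    unfold sampleLaw; infer_instance
  have hm' : (0 : ℝ) < m := by exact_mod_cast hm
  set n : ℝ := (m : ℝ) + m with hn
  have hn0 : 0 < n := by positivity
  have hs0 : 0 < Real.sqrt n := Real.sqrt_pos.2 hn0
  have hsd : 0 < Real.sqrt d := Real.sqrt_pos.2 hd
  have hsd2 : Real.sqrt d ≤ 2 := by
    rw [Real.sqrt_le_left (by norm_num)]; linarith
  have hτ : 0 < Real.sqrt (Θ ⬝ᵥ (S *ᵥ Θ)) := Real.sqrt_pos.2 hpos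
  have hF : ∀ y, auxF (m + m) (y / Real.sqrt (d * (Θ ⬝ᵥ (S *ᵥ Θ)))) =
      (sampleLaw (m + m) μx β).real {ω | Real.sqrt d * ((Real.sqrt n)⁻¹ *
        ∑ i, (∑ j, Θ j * (ω i).1 j) * ((ω i).2 - ∑ j, (ω i).1 j * β j)) ≤ y} := by
    intro y
    have := aux_law h β Θ hpos (m + m) (y / Real.sqrt (d * (Θ ⬝ᵥ (S *ᵥ Θ))))
    rw [auxF, ← this, Measure.real]
    congr 2
    ext ω
    simp only [Set.mem_ofPred_eq, Nat.cast_add, ← hn]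
    rw [Real.sqrt_mul hd.le, ← le_div_iff₀' hsd]
    have e : Real.sqrt (Θ ⬝ᵥ (S *ᵥ Θ)) * (y / (Real.sqrt d * Real.sqrt (Θ ⬝ᵥ (S *ᵥ Θ))))
      = y / Real.sqrt d := by field_simp
    rw [e]
  have key : ∀ ω : Fin (m + m) → (Fin (q + 1) → ℝ) × ℝ,
      Real.sqrt n *
              ((debiasedHalf m Θ (βII (secondHalf ω)) (firstHalf ω) +
                  debiasedHalf m Θ (βI (firstHalf ω)) (secondHalf ω)) / 2 - β 0) /
                Real.sqrt (d⁻¹)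
      = Real.sqrt d * ((Real.sqrt n)⁻¹ *
        ∑ i, (∑ j, Θ j * (ω i).1 j) * ((ω i).2 - ∑ j, (ω i).1 j * β j))
        + Real.sqrt d * (Real.sqrt n * auxT m Θ β βI βII ω) := by
    intro ω
    rw [auxT, Real.sqrt_inv, div_inv_eq_mul, ← hn]
    have e : (Real.sqrt n)⁻¹ = Real.sqrt n / n := by
      rw [inv_eq_one_div, div_eq_div_iff hs0.ne' hn0.ne', Real.mul_self_sqrt hn0.le, one_mul]
    rw [e]
    ring
  have key2 : ∀ ω : Fin (m + m) → (Fin (q + 1) → ℝ) × ℝ,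
      ¬ (ρ / 2 * (Real.sqrt n)⁻¹ < |auxT m Θ β βI βII ω|) →
      |Real.sqrt d * (Real.sqrt n * auxT m Θ β βI βII ω)| ≤ ρ := by
    intro ω hω
    rw [not_lt] at hω
    rw [abs_mul, abs_mul, abs_of_pos hsd, abs_of_pos hs0]
    calc Real.sqrt d * (Real.sqrt n * |auxT m Θ β βI βII ω|)
        ≤ 2 * (Real.sqrt n * (ρ / 2 * (Real.sqrt n)⁻¹)) := by gcongr
      _ = ρ := by field_simp
  rw [hF, hF]
  simp_rw [key] at hE
  change E = (sampleLaw (m + m) μx β).real _ at hE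
  change (sampleLaw (m + m) μx β).real _ ≤ K at hK
  constructor
  · rw [hE]
    refine le_trans ?_ (add_le_add le_rfl hK)
    refine le_trans (measureReal_mono fun ω hω => ?_) (measureReal_union_le _ _)
    by_cases hb : ρ / 2 * (Real.sqrt n)⁻¹ < |auxT m Θ β βI βII ω|
    · right; exact hb
    · left
      have := abs_le.1 (key2 ω hb)
      simp only [Set.mem_ofPred_eq] at hω ⊢
      linarith
  · rw [hE]
    refine le_trans ?_ (add_le_add le_rfl hK)
    refine le_trans (measureReal_mono fun ω hω => ?_) (measureReal_union_le _ _)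
    by_cases hb : ρ / 2 * (Real.sqrt n)⁻¹ < |auxT m Θ β βI βII ω|
    · right; exact hb
    · left
      have := abs_le.1 (key2 ω hb)
      simp only [Set.mem_ofPred_eq] at hω ⊢
      linarith

/-- Theorem `bsharp.theorem`: asymptotic linearity and uniform asymptotic
normality of the sample-split debiased estimator based on an eligible pair, with asymptotic
variance `Θ₁,₁♯`. The asymptotics are along the half-sample size `m`; the sample size is
`n = m + m`. -/
theorem debiased_estimator_known_sigma
    -- dimensions: p = k + 1
    (k : ℕ → ℕ) (hk : ∀ m, 1 ≤ k m)
    -- covariance matrices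
    (Sig : ∀ m, Matrix (Fin (k m + 1)) (Fin (k m + 1)) ℝ)
    (hsymm : ∀ m, (Sig m).IsSymm)
    (hpos : ∀ m, (Sig m).PosDef)
    (hdiag : ∀ m i, Sig m i i = 1)
    (c₀ : ℝ) (hc₀ : 0 < c₀)
    (heig : ∀ m i, c₀ ≤ (hpos m).1.eigenvalues i)
    -- the Gaussian design distribution
    (μx : ∀ m, Measure (Fin (k m + 1) → ℝ))
    (hμx : ∀ m, IsCenteredGaussianLaw (μx m) (Sig m))
    -- the model class
    (B : ∀ m, Set (Fin (k m + 1) → ℝ))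
    -- γ⁰ : coefficients of the regression of the first variable on the others
    (γ0 : ∀ m, Fin (k m) → ℝ)
    (hγ0 : ∀ m, minorMat (Sig m) *ᵥ γ0 m = fun j => Sig m j.succ 0)
    -- the eligible pair (γ♯, λ♯)
    (lam : ℕ → ℝ) (hlam : ∀ m, 0 < lam m)
    (γs : ∀ m, Fin (k m) → ℝ)
    (hE1 : ∀ m j, |(minorMat (Sig m) *ᵥ (fun l => γs m l - γ0 m l)) j| ≤ lam m)
    (hE2 : Tendsto (fun m => lam m * ∑ j, |γs m j|) atTop (nhds 0))
    -- estimators based on the two halves of the sample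
    (βI βII : ∀ m, (Fin m → (Fin (k m + 1) → ℝ) × ℝ) → (Fin (k m + 1) → ℝ))
    (hβImeas : ∀ m, Measurable (βI m)) (hβIImeas : ∀ m, Measurable (βII m))
    -- ‖Σ^{1/2}(β̂_I - β⁰)‖₂ = o_P(1) and ‖Σ^{1/2}(β̂_II - β⁰)‖₂ = o_P(1), uniformly in β⁰ ∈ B
    (hβIl2 : ∀ η : ℝ, 0 < η → Tendsto (fun m => ⨆ b : B m,
        sampleLaw (m + m) (μx m) b.1
          {ω | η < Real.sqrt ((fun j => βI m (firstHalf ω) j - b.1 j) ⬝ᵥ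
              (Sig m *ᵥ (fun j => βI m (firstHalf ω) j - b.1 j)))})
        atTop (nhds 0))
    (hβIIl2 : ∀ η : ℝ, 0 < η → Tendsto (fun m => ⨆ b : B m,
        sampleLaw (m + m) (μx m) b.1
          {ω | η < Real.sqrt ((fun j => βII m (secondHalf ω) j - b.1 j) ⬝ᵥ
              (Sig m *ᵥ (fun j => βII m (secondHalf ω) j - b.1 j)))})
        atTop (nhds 0))
    -- √n λ♯ ‖β̂_I - β⁰‖₁ = o_P(1) and √n λ♯ ‖β̂_II - β⁰‖₁ = o_P(1), uniformly in β⁰ ∈ B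
    (hβIl1 : ∀ η : ℝ, 0 < η → Tendsto (fun m => ⨆ b : B m,
        sampleLaw (m + m) (μx m) b.1
          {ω | η < Real.sqrt (m + m) * lam m * ∑ j, |βI m (firstHalf ω) j - b.1 j|})
        atTop (nhds 0))
    (hβIIl1 : ∀ η : ℝ, 0 < η → Tendsto (fun m => ⨆ b : B m,
        sampleLaw (m + m) (μx m) b.1
          {ω | η < Real.sqrt (m + m) * lam m * ∑ j, |βII m (secondHalf ω) j - b.1 j|})
        atTop (nhds 0)) :
    -- conclusion 1: uniformly in β⁰ ∈ B,
    -- b̂₁♯ - β₁⁰ = Θ₁♯ᵀ Xᵀ ε / n + o_P(1/√n)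
    (∀ η : ℝ, 0 < η → Tendsto (fun m => ⨆ b : B m,
        sampleLaw (m + m) (μx m) b.1
          {ω | η * (Real.sqrt (m + m))⁻¹ <
            |(debiasedHalf m (thetaSharp (Sig m) (γ0 m) (γs m))
                  (βII m (secondHalf ω)) (firstHalf ω) +
                debiasedHalf m (thetaSharp (Sig m) (γ0 m) (γs m))
                  (βI m (firstHalf ω)) (secondHalf ω)) / 2
              - b.1 0
              - (∑ i, (∑ j, thetaSharp (Sig m) (γ0 m) (γs m) j * (ω i).1 j) *
                  ((ω i).2 - ∑ j, (ω i).1 j * b.1 j)) / (m + m)|})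
        atTop (nhds 0)) ∧
    -- conclusion 2: uniform asymptotic normality with asymptotic variance Θ₁,₁♯
    (∀ z : ℝ, Tendsto (fun m => ⨆ b : B m,
        |(sampleLaw (m + m) (μx m) b.1
          {ω | Real.sqrt (m + m) *
              ((debiasedHalf m (thetaSharp (Sig m) (γ0 m) (γs m))
                    (βII m (secondHalf ω)) (firstHalf ω) +
                  debiasedHalf m (thetaSharp (Sig m) (γ0 m) (γs m))
                    (βI m (firstHalf ω)) (secondHalf ω)) / 2 - b.1 0) /
                Real.sqrt ((1 - γ0 m ⬝ᵥ (minorMat (Sig m) *ᵥ γs m))⁻¹) ≤ z}).toReal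
          - stdNormCDF z|)
        atTop (nhds 0)) := by
  have hr0 : ∀ᶠ m in atTop, lam m * ∑ j, |γs m j| ≤ c₀ / 2 :=
    (hE2.eventually (gt_mem_nhds (half_pos hc₀))).mono fun m h => h.le
  have C1 : ∀ η : ℝ, 0 < η → Tendsto (fun m => ⨆ b : B m,
        sampleLaw (m + m) (μx m) b.1
          {ω | η * (Real.sqrt (m + m))⁻¹ <
            |auxT m (thetaSharp (Sig m) (γ0 m) (γs m)) b.1 (βI m) (βII m) ω|})
        atTop (nhds 0) := by
    intro η hη
    rw [ENNReal.tendsto_nhds_zero]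
    intro ε hε
    have hlim : Tendsto (fun x : ℝ => 2 * ENNReal.ofReal
        (auxK * ((4 / c₀) ^ 2 + 1) * 8 / η ^ 2 * x ^ 2)) (nhds 0) (nhds 0) := by
      have h1 : Tendsto (fun x : ℝ => auxK * ((4 / c₀) ^ 2 + 1) * 8 / η ^ 2 * x ^ 2)
          (nhds 0) (nhds 0) := by
        have : Continuous (fun x : ℝ => auxK * ((4 / c₀) ^ 2 + 1) * 8 / η ^ 2 * x ^ 2) := by
          fun_prop
        simpa using this.tendsto 0
      have h2 := ENNReal.Tendsto.const_mul (a := 2) (ENNReal.tendsto_ofReal h1)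
        (Or.inr (by simp))
      simpa using h2
    have hε2 : 0 < ε / 2 := ENNReal.half_pos hε.ne'
    obtain ⟨η', hη'1, hη'⟩ := (((hlim.eventually (gt_mem_nhds hε2)).filter_mono
      nhdsWithin_le_nhds).and (self_mem_nhdsWithin (s := Set.Ioi 0))).exists
    have hη' : 0 < η' := hη'
    have hη2 : 0 < η * c₀ / 4 := by positivity
    have hsum := (((hβIIl1 _ hη2).add (hβIl1 _ hη2)).add (hβIIl2 _ hη')).add (hβIl2 _ hη')
    simp only [add_zero] at hsum
    filter_upwards [hsum.eventually (gt_mem_nhds hε2), hr0, eventually_gt_atTop 0] with m h1 h2 h3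
    refine iSup_le fun b => ?_
    refine (aux_bound (hμx m) (hpos m) (hsymm m) (hdiag m) (hγ0 m) (lam m) (hlam m) (hE1 m) c₀ hc₀
      (heig m) h2 m h3 b.1 (βI m) (βII m) (hβImeas m) (hβIImeas m) η η' hη hη').trans ?_
    rw [← ENNReal.add_halves ε]
    refine add_le_add (le_trans ?_ h1.le) hη'1.le
    refine add_le_add (add_le_add (add_le_add ?_ ?_) ?_) ?_
    · exact le_iSup (fun b : B m => sampleLaw (m + m) (μx m) b.1 {ω | η * c₀ / 4 <
        Real.sqrt (m + m) * lam m * ∑ j, |βII m (secondHalf ω) j - b.1 j|}) b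
    · exact le_iSup (fun b : B m => sampleLaw (m + m) (μx m) b.1 {ω | η * c₀ / 4 <
        Real.sqrt (m + m) * lam m * ∑ j, |βI m (firstHalf ω) j - b.1 j|}) b
    · exact le_iSup (fun b : B m => sampleLaw (m + m) (μx m) b.1
          {ω | η' < Real.sqrt ((fun j => βII m (secondHalf ω) j - b.1 j) ⬝ᵥ
              (Sig m *ᵥ (fun j => βII m (secondHalf ω) j - b.1 j)))}) b
    · exact le_iSup (fun b : B m => sampleLaw (m + m) (μx m) b.1
          {ω | η' < Real.sqrt ((fun j => βI m (firstHalf ω) j - b.1 j) ⬝ᵥ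
              (Sig m *ᵥ (fun j => βI m (firstHalf ω) j - b.1 j)))}) b
  refine ⟨C1, fun z => ?_⟩
  have hs : Tendsto (fun m => Real.sqrt (auxD (Sig m) (γ0 m) (γs m) *
      (thetaSharp (Sig m) (γ0 m) (γs m) ⬝ᵥ (Sig m *ᵥ thetaSharp (Sig m) (γ0 m) (γs m)))))
      atTop (nhds 1) := by
    rw [← Real.sqrt_one]
    refine (Real.continuous_sqrt.tendsto 1).comp ?_
    rw [tendsto_iff_norm_sub_tendsto_zero]
    refine squeeze_zero' (Eventually.of_forall fun m => norm_nonneg _) ?_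
      (by simpa using hE2.const_mul (2 / c₀))
    filter_upwards [hr0] with m h2
    exact (aux_const (hpos m) (hsymm m) (hdiag m) (hγ0 m) (lam m) (hE1 m) c₀ hc₀
      (heig m) h2).2.2.2.2
  have hF : ∀ y, Tendsto (fun m : ℕ => auxF (m + m) y) atTop (nhds (stdNormCDF y)) := fun y =>
    (aux_clt y).comp (tendsto_atTop_mono (fun m => Nat.le_add_left m m) tendsto_id)
  rw [Metric.tendsto_atTop']
  suffices H : ∀ ε > 0, ∀ᶠ m in atTop, ∀ b : B m, |(sampleLaw (m + m) (μx m) b.1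
          {ω | Real.sqrt (m + m) *
              ((debiasedHalf m (thetaSharp (Sig m) (γ0 m) (γs m))
                    (βII m (secondHalf ω)) (firstHalf ω) +
                  debiasedHalf m (thetaSharp (Sig m) (γ0 m) (γs m))
                    (βI m (firstHalf ω)) (secondHalf ω)) / 2 - b.1 0) /
                Real.sqrt ((auxD (Sig m) (γ0 m) (γs m))⁻¹) ≤ z}).toReal
          - stdNormCDF z| ≤ ε by
    intro ε hε
    obtain ⟨N, hN⟩ := eventually_atTop.1 (H (ε / 2) (half_pos hε))
    refine ⟨N, fun m hm => ?_⟩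
    rw [Real.dist_eq, sub_zero, abs_of_nonneg (Real.iSup_nonneg fun b => abs_nonneg _)]
    refine lt_of_le_of_lt (Real.iSup_le (fun b => hN m hm.le b) (half_pos hε).le) (half_lt_self hε)
  intro ε hε
  obtain ⟨ρ, hρ, hΦ1, hΦ2⟩ := aux_phi z (ε / 3) (by positivity)
  have hC := C1 (ρ / 2) (half_pos hρ)
  have hε3 : 0 < ε / 3 := by positivity
  have u1 : ∀ᶠ m in atTop, (z + ρ) / Real.sqrt (auxD (Sig m) (γ0 m) (γs m) *
      (thetaSharp (Sig m) (γ0 m) (γs m) ⬝ᵥ (Sig m *ᵥ thetaSharp (Sig m) (γ0 m) (γs m))))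
      < z + 2 * ρ := by
    have := (tendsto_const_nhds (x := z + ρ)).div hs one_ne_zero
    exact this.eventually (gt_mem_nhds (by rw [div_one]; linarith))
  have u2 : ∀ᶠ m in atTop, z - 2 * ρ < (z - ρ) / Real.sqrt (auxD (Sig m) (γ0 m) (γs m) *
      (thetaSharp (Sig m) (γ0 m) (γs m) ⬝ᵥ (Sig m *ᵥ thetaSharp (Sig m) (γ0 m) (γs m)))) := by
    have := (tendsto_const_nhds (x := z - ρ)).div hs one_ne_zero
    exact this.eventually (lt_mem_nhds (by rw [div_one]; linarith))
  filter_upwards [hr0, hE2.eventually (gt_mem_nhds (show (0 : ℝ) < 3 by norm_num)),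
    eventually_gt_atTop 0, u1, u2,
    hC.eventually (gt_mem_nhds (ENNReal.ofReal_pos.2 hε3)),
    (hF (z + 2 * ρ)).eventually (gt_mem_nhds (lt_add_of_pos_right _ hε3)),
    (hF (z - 2 * ρ)).eventually (lt_mem_nhds (sub_lt_self _ hε3))]
    with m h1 h2 h3 h4 h5 h6 h7 h8 b
  obtain ⟨k1, k2, k3, -, -⟩ := aux_const (hpos m) (hsymm m) (hdiag m) (hγ0 m) (lam m) (hE1 m) c₀ hc₀
      (heig m) h1
  have hK := ENNReal.toReal_le_of_le_ofReal hε3.le ((le_iSup (fun b : B m =>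
    sampleLaw (m + m) (μx m) b.1
          {ω | ρ / 2 * (Real.sqrt (m + m))⁻¹ <
            |auxT m (thetaSharp (Sig m) (γ0 m) (γs m)) b.1 (βI m) (βII m) ω|}) b).trans h6.le)
  obtain ⟨v1, v2⟩ := aux_sandwich (hμx m) (thetaSharp (Sig m) (γ0 m) (γs m)) b.1 k3
    (auxD (Sig m) (γ0 m) (γs m)) (by linarith) (by linarith) m h3 (βI m) (βII m) z ρ (ε / 3) hρ hK
    _ rfl
  have w1 := auxF_mono (m + m) h4.le
  have w2 := auxF_mono (m + m) h5.le
  rw [abs_le]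
  constructor <;> linarith
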